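/- Let a, b be real numbers with a < 1, b < 1 and a + b = 1 − 2k for some nonnegative integer k. Then for every integer N ≥ 2k + 1 there exist real numbers c̃_0, …, c̃_N such that, as t ↓ 0, h_{a,b}(t) = Σ_{n=0}^{N} c̃_n t^{n/2} − (a(a+1)⋯(a+2k−1)/(2·k!)) t^{k} log t + O(t^{(N+1)/2}), where the product a(a+1)⋯(a+2k−1) is interpreted as 1 when k = 0. -/

import Mathlib

open MeasureTheory

/-- The heat content of `[0,1]` in `ℝ` with initial temperature `x^{-a}` and
specific heat `y^{-b}`, for complex `a`, `b`. -/
noncomputable def heatContentI (a b : ℂ) (t : ℝ) : ℂ :=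
  (↑(Real.sqrt (4 * Real.pi * t)) : ℂ)⁻¹ *
    ∫ x in (0:ℝ)..1, ∫ y in (0:ℝ)..1,
      (↑(Real.exp (-(x - y) ^ 2 / (4 * t))) : ℂ) * (x : ℂ) ^ (-a) * (y : ℂ) ^ (-b)

open Set

/-- The half-line moments `∫₀^∞ wⁿ e^{-w²/4} dw`. -/
noncomputable def halfGaussianMoment (n : ℕ) : ℝ :=
  ∫ w in Ioi (0 : ℝ), Real.exp (-w ^ 2 / 4) * w ^ n

lemma integrableOn_exp_neg_sq_mul_pow {ρ : ℝ} (hρ : 0 < ρ) (n : ℕ) :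
    IntegrableOn (fun w : ℝ => Real.exp (-(ρ * w) ^ 2 / 4) * w ^ n) (Ioi 0) := by
  have h := integrableOn_rpow_mul_exp_neg_mul_sq (b := ρ ^ 2 / 4) (by positivity) (s := n)
    (by have : (0 : ℝ) ≤ n := n.cast_nonneg
        linarith)
  refine h.congr_fun (fun w _ => ?_) measurableSet_Ioi
  simp only [Real.rpow_natCast]
  rw [mul_comm]
  congr 2
  ring

lemma integral_exp_neg_sq_mul_pow {ρ : ℝ} (hρ : 0 < ρ) (n : ℕ) :
    ∫ w in Ioi (0 : ℝ), Real.exp (-(ρ * w) ^ 2 / 4) * w ^ n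
      = halfGaussianMoment n / ρ ^ (n + 1) := by
  have h := integral_comp_mul_left_Ioi (fun w : ℝ => Real.exp (-w ^ 2 / 4) * w ^ n) 0 hρ
  simp only [mul_zero, smul_eq_mul] at h
  change _ = ρ⁻¹ * halfGaussianMoment n at h
  have e : ∀ w : ℝ, Real.exp (-(ρ * w) ^ 2 / 4) * w ^ n
      = (ρ ^ n)⁻¹ * (Real.exp (-(ρ * w) ^ 2 / 4) * (ρ * w) ^ n) := by
    intro w
    rw [mul_pow ρ w n]
    field_simp
  simp_rw [e]
  rw [integral_const_mul, h, pow_succ]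
  field_simp

lemma halfGaussianMoment_two_mul (k : ℕ) :
    halfGaussianMoment (2 * k) = √Real.pi * (2 * k).factorial / k.factorial := by
  have h := integral_rpow_mul_exp_neg_mul_rpow (p := 2) (q := (2 * k : ℕ)) (b := 1 / 4)
    (by norm_num) (by have : (0 : ℝ) ≤ (2 * k : ℕ) := Nat.cast_nonneg _
                      linarith) (by norm_num)
  have e : halfGaussianMoment (2 * k)
      = ∫ x in Ioi (0 : ℝ), x ^ ((2 * k : ℕ) : ℝ) * Real.exp (-(1 / 4) * x ^ (2 : ℝ)) := by
    refine setIntegral_congr_fun measurableSet_Ioi (fun w _ => ?_)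
    simp only [Real.rpow_natCast, Real.rpow_two]
    rw [mul_comm]
    congr 2
    ring
  rw [e, h]
  have hk : (((2 * k : ℕ) : ℝ) + 1) / 2 = k + 1 / 2 := by
    push_cast
    ring
  rw [neg_div, hk]
  have hG := Real.Gamma_mul_Gamma_add_half (k + 1 / 2)
  have e1 : (k : ℝ) + 1 / 2 + 1 / 2 = k + 1 := by ring
  have e2 : (2 : ℝ) * (k + 1 / 2) = (2 * k : ℕ) + 1 := by
    push_cast
    ring
  rw [e1, e2, Real.Gamma_nat_eq_factorial, Real.Gamma_nat_eq_factorial] at hG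
  have hf : (k.factorial : ℝ) ≠ 0 := by positivity
  rw [eq_div_iff hf, mul_assoc, hG]
  have e3 : (1 / 4 : ℝ) ^ (-((k : ℝ) + 1 / 2)) = 4 ^ k * 2 := by
    rw [one_div, Real.inv_rpow (by norm_num), Real.rpow_neg (by norm_num), inv_inv,
      Real.rpow_add (by norm_num), Real.rpow_natCast, ← Real.sqrt_eq_rpow,
      show (4 : ℝ) = 2 ^ 2 by norm_num, Real.sqrt_sq (by norm_num)]
  have e4 : (2 : ℝ) ^ (1 - (((2 * k : ℕ) : ℝ) + 1)) = (4 ^ k)⁻¹ := by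
    rw [show 1 - (((2 * k : ℕ) : ℝ) + 1) = -((2 * k : ℕ) : ℝ) by ring,
      Real.rpow_neg (by norm_num), Real.rpow_natCast, pow_mul]
    norm_num
  rw [e3, e4]
  field_simp

lemma exists_exp_neg_sq_le {δ : ℝ} (hδ : 0 < δ) (m : ℕ) :
    ∃ A : ℝ, 0 < A ∧ ∀ ρ : ℝ, 1 ≤ ρ → Real.exp (-(ρ * δ) ^ 2 / 4) ≤ A / ρ ^ m := by
  refine ⟨m.factorial * (4 / δ ^ 2) ^ m, by positivity, fun ρ hρ => ?_⟩
  have hρ0 : 0 < ρ := by linarith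
  have h := Real.pow_div_factorial_le_exp ((ρ * δ) ^ 2 / 4) (by positivity) m
  rw [neg_div, Real.exp_neg, inv_le_comm₀ (Real.exp_pos _) (by positivity)]
  refine le_trans ?_ h
  have : (m.factorial * (4 / δ ^ 2) ^ m / ρ ^ m)⁻¹
      = ρ ^ m * (δ ^ 2 / 4) ^ m / m.factorial := by
    rw [inv_div, div_pow, div_pow]
    field_simp
  rw [this, ← mul_pow]
  gcongr
  nlinarith [sq_nonneg δ, mul_nonneg (sub_nonneg.2 hρ) hρ0.le, sq_nonneg (ρ * δ),
    mul_nonneg (mul_nonneg (sub_nonneg.2 hρ) hρ0.le) (sq_nonneg δ)]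

/-- Watson's lemma for the Gaussian kernel. -/
lemma watson_gaussian {f : ℝ → ℝ} (hf : IntegrableOn f (Ioi 0)) (p : ℕ → ℝ) (N : ℕ)
    {C δ : ℝ} (hC : 0 ≤ C) (hδ : 0 < δ)
    (hp : ∀ w, 0 < w → w < δ →
      |f w - ∑ n ∈ Finset.range (N + 1), p n * w ^ n| ≤ C * w ^ (N + 1)) :
    ∃ K : ℝ, ∀ ρ : ℝ, 1 ≤ ρ →
      |(∫ w in Ioi (0 : ℝ), Real.exp (-(ρ * w) ^ 2 / 4) * f w)
        - ∑ n ∈ Finset.range (N + 1), p n * halfGaussianMoment n / ρ ^ (n + 1)|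
        ≤ K / ρ ^ (N + 2) := by
  obtain ⟨A, hA, hAe⟩ := exists_exp_neg_sq_le hδ (N + 2)
  set S : ℝ := ∑ n ∈ Finset.range (N + 1), |p n| / δ ^ (N + 1 - n) with hS
  have hS0 : 0 ≤ S := Finset.sum_nonneg fun n _ => by positivity
  refine ⟨(C + S) * halfGaussianMoment (N + 1) + A * ∫ w in Ioi (0 : ℝ), |f w|, fun ρ hρ => ?_⟩
  have hρ0 : 0 < ρ := by linarith
  have hef : IntegrableOn (fun w => Real.exp (-(ρ * w) ^ 2 / 4) * f w) (Ioi 0) := by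
    refine Integrable.mono hf ((by fun_prop : Measurable fun w : ℝ =>
      Real.exp (-(ρ * w) ^ 2 / 4)).aestronglyMeasurable.mul hf.1) (ae_of_all _ fun w => ?_)
    rw [norm_mul, Real.norm_of_nonneg (Real.exp_pos _).le]
    exact mul_le_of_le_one_left (norm_nonneg _) (Real.exp_le_one_iff.2 (by nlinarith [sq_nonneg (ρ * w)]))
  have hsum : ∑ n ∈ Finset.range (N + 1), p n * halfGaussianMoment n / ρ ^ (n + 1)
      = ∫ w in Ioi (0 : ℝ), ∑ n ∈ Finset.range (N + 1),
          p n * (Real.exp (-(ρ * w) ^ 2 / 4) * w ^ n) := by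
    rw [integral_finsetSum _ fun n _ => (integrableOn_exp_neg_sq_mul_pow hρ0 n).const_mul _]
    refine Finset.sum_congr rfl fun n _ => ?_
    rw [integral_const_mul, integral_exp_neg_sq_mul_pow hρ0, mul_div_assoc]
  have hsumi : IntegrableOn (fun w : ℝ => ∑ n ∈ Finset.range (N + 1),
      p n * (Real.exp (-(ρ * w) ^ 2 / 4) * w ^ n)) (Ioi 0) :=
    integrable_finsetSum _ fun n _ => (integrableOn_exp_neg_sq_mul_pow hρ0 n).const_mul _
  rw [hsum, ← integral_sub hef hsumi]
  have hb1 := (integrableOn_exp_neg_sq_mul_pow hρ0 (N + 1)).const_mul (C + S)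
  have hb2 := hf.abs.const_mul (A / ρ ^ (N + 2))
  have key : |∫ w in Ioi (0 : ℝ), (Real.exp (-(ρ * w) ^ 2 / 4) * f w
      - ∑ n ∈ Finset.range (N + 1), p n * (Real.exp (-(ρ * w) ^ 2 / 4) * w ^ n))|
      ≤ ∫ w in Ioi (0 : ℝ), ((C + S) * (Real.exp (-(ρ * w) ^ 2 / 4) * w ^ (N + 1))
        + A / ρ ^ (N + 2) * |f w|) := by
    rw [← Real.norm_eq_abs]
    refine norm_integral_le_of_norm_le (hb1.add hb2) ?_
    rw [ae_restrict_iff' measurableSet_Ioi]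
    refine ae_of_all _ fun w (hw : 0 < w) => ?_
    set e := Real.exp (-(ρ * w) ^ 2 / 4) with he
    have he0 : 0 < e := Real.exp_pos _
    have hfac : e * f w - ∑ n ∈ Finset.range (N + 1), p n * (e * w ^ n)
        = e * (f w - ∑ n ∈ Finset.range (N + 1), p n * w ^ n) := by
      rw [mul_sub, Finset.mul_sum]
      congr 1
      exact Finset.sum_congr rfl fun n _ => by ring
    rw [hfac, Real.norm_eq_abs, abs_mul, abs_of_pos he0]
    rcases lt_or_ge w δ with h | h
    · calc e * |f w - ∑ n ∈ Finset.range (N + 1), p n * w ^ n|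
          ≤ e * (C * w ^ (N + 1)) := by gcongr; exact hp w hw h
        _ ≤ (C + S) * (e * w ^ (N + 1)) := by
            have : 0 ≤ S * (e * w ^ (N + 1)) := by positivity
            linarith
        _ ≤ _ := le_add_of_nonneg_right (by positivity)
    · have h1 : |∑ n ∈ Finset.range (N + 1), p n * w ^ n| ≤ S * w ^ (N + 1) := by
        rw [hS, Finset.sum_mul]
        refine (Finset.abs_sum_le_sum_abs _ _).trans (Finset.sum_le_sum fun n hn => ?_)
        have hn' : n ≤ N + 1 := (Finset.mem_range.1 hn).le
        rw [abs_mul, abs_of_nonneg (by positivity : 0 ≤ w ^ n), div_mul_eq_mul_div,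
          le_div_iff₀ (by positivity), mul_assoc]
        gcongr
        calc w ^ n * δ ^ (N + 1 - n) ≤ w ^ n * w ^ (N + 1 - n) := by gcongr
          _ = w ^ (N + 1) := by rw [← pow_add, Nat.add_sub_cancel' hn']
      have h2 : e ≤ A / ρ ^ (N + 2) := by
        refine le_trans ?_ (hAe ρ hρ)
        rw [he]
        gcongr
      calc e * |f w - ∑ n ∈ Finset.range (N + 1), p n * w ^ n|
          ≤ e * (|f w| + S * w ^ (N + 1)) := by
            gcongr
            exact (abs_sub _ _).trans (by gcongr)
        _ = e * |f w| + S * (e * w ^ (N + 1)) := by ring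
        _ ≤ A / ρ ^ (N + 2) * |f w| + (C + S) * (e * w ^ (N + 1)) := by
            gcongr
            linarith
        _ = _ := add_comm _ _
  refine key.trans (le_of_eq ?_)
  rw [integral_add hb1 hb2, integral_const_mul, integral_const_mul,
    integral_exp_neg_sq_mul_pow hρ0]
  ring

/-- The function `(1 - w)^{-b}` on `w < 1`, extended by zero. -/
noncomputable def truncPow (b w : ℝ) : ℝ :=
  (Iio (1 : ℝ)).indicator (fun w => (1 - w) ^ (-b)) w

lemma integrableOn_truncPow {b : ℝ} (hb : b < 1) : IntegrableOn (truncPow b) (Ioi 0) := by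
  have h : IntervalIntegrable (fun w : ℝ => (1 - w) ^ (-b)) volume 0 1 := by
    have := (intervalIntegral.intervalIntegrable_rpow' (a := 0) (b := 1) (r := -b)
      (by linarith)).comp_sub_left 1
    simpa using this.symm
  rw [intervalIntegrable_iff_integrableOn_Ioo_of_le zero_le_one] at h
  change Integrable ((Iio (1 : ℝ)).indicator fun w => (1 - w) ^ (-b)) _
  rw [integrable_indicator_iff measurableSet_Iio, IntegrableOn,
    Measure.restrict_restrict measurableSet_Iio, inter_comm, Ioi_inter_Iio]
  exact h

lemma truncPow_expansion (b : ℝ) (N : ℕ) :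
    ∃ C δ : ℝ, 0 ≤ C ∧ 0 < δ ∧ ∀ w, 0 < w → w < δ →
      |truncPow b w - ∑ n ∈ Finset.range (N + 1),
        (∏ i ∈ Finset.range n, (b + i)) / n.factorial * w ^ n| ≤ C * w ^ (N + 1) := by
  have hps := (Real.one_div_one_sub_rpow_hasFPowerSeriesOnBall_zero b).hasFPowerSeriesAt
  have h := hps.isBigO_sub_partialSum_pow (N + 1)
  obtain ⟨C, hC, hb⟩ := h.exists_nonneg
  rw [Asymptotics.isBigOWith_iff, Metric.eventually_nhds_iff] at hb
  obtain ⟨δ, hδ, hb⟩ := hb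
  refine ⟨C, min δ 1, hC, lt_min hδ one_pos, fun w hw hwδ => ?_⟩
  have hw1 : w < 1 := hwδ.trans_le (min_le_right _ _)
  have := @hb w (by simpa [abs_of_pos hw] using hwδ.trans_le (min_le_left _ _))
  have hcoef : ∀ n : ℕ, Ring.choose (b + n - 1) n
      = (∏ i ∈ Finset.range n, (b + i)) / n.factorial := by
    intro n
    rw [Ring.choose_eq_smul, Polynomial.descPochhammer_smeval_eq_ascPochhammer,
      Polynomial.ascPochhammer_smeval_eq_eval, ← descPochhammer_eval_eq_ascPochhammer,
      descPochhammer_eval_eq_prod_range, smul_eq_mul, ← Finset.prod_range_reflect, div_eq_inv_mul]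
    congr 1
    refine Finset.prod_congr rfl fun i hi => ?_
    have hi' : i + 1 ≤ n := Finset.mem_range.1 hi
    rw [Nat.sub_sub, add_comm 1 i, Nat.cast_sub hi']
    push_cast
    ring
  have hsum : (FormalMultilinearSeries.ofScalars (𝕜 := ℝ) ℝ
      fun n : ℕ => Ring.choose (b + n - 1) n).partialSum (N + 1) w
      = ∑ n ∈ Finset.range (N + 1), (∏ i ∈ Finset.range n, (b + i)) / n.factorial * w ^ n := by
    rw [FormalMultilinearSeries.partialSum]
    refine Finset.sum_congr rfl fun n _ => ?_
    rw [FormalMultilinearSeries.ofScalars_apply_eq, hcoef, smul_eq_mul]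
  rw [hsum] at this
  rw [truncPow, indicator_of_mem (show w ∈ Iio (1 : ℝ) from hw1), Real.rpow_neg (by linarith)]
  simpa [abs_of_pos hw] using this

/-- The one-dimensional boundary integral `∫₀¹ e^{-(ρw)²/4} (1-w)^{-b} dw`. -/
noncomputable def boundaryLayer (b ρ : ℝ) : ℝ :=
  ∫ w in Ioi (0 : ℝ), Real.exp (-(ρ * w) ^ 2 / 4) * truncPow b w

lemma continuous_boundaryLayer {b : ℝ} (hb : b < 1) : Continuous (boundaryLayer b) := by
  have hi := integrableOn_truncPow hb
  refine continuous_of_dominated (bound := fun w => ‖truncPow b w‖) (fun ρ => ?_) (fun ρ => ?_)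
    hi.norm (ae_of_all _ fun w => by fun_prop)
  · exact (by fun_prop : Measurable fun w : ℝ =>
      Real.exp (-(ρ * w) ^ 2 / 4)).aestronglyMeasurable.mul hi.1
  · refine ae_of_all _ fun w => ?_
    rw [norm_mul, Real.norm_of_nonneg (Real.exp_pos _).le]
    exact mul_le_of_le_one_left (norm_nonneg _)
      (Real.exp_le_one_iff.2 (by nlinarith [sq_nonneg (ρ * w)]))

lemma boundaryLayer_eq (b ρ : ℝ) :
    boundaryLayer b ρ = ∫ w in (0 : ℝ)..1, Real.exp (-(ρ * w) ^ 2 / 4) * (1 - w) ^ (-b) := by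
  rw [intervalIntegral.integral_of_le zero_le_one, integral_Ioc_eq_integral_Ioo, boundaryLayer,
    ← Ioi_inter_Iio, inter_comm, ← Measure.restrict_restrict measurableSet_Iio,
    ← integral_indicator measurableSet_Iio]
  refine integral_congr_ae (ae_of_all _ fun w => ?_)
  by_cases hw : w < 1 <;> simp [truncPow, hw]

lemma pow_mul_integral_pow_div_pow {s : ℝ} (hs : 0 < s) (m n : ℕ) :
    s ^ m * ∫ ρ in (1 : ℝ)..s⁻¹, ρ ^ m / ρ ^ (n + 1)
      = (s ^ n - s ^ m) / ((m : ℝ) - n) + if n = m then -(s ^ m * Real.log s) else 0 := by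
  have hpos : ∀ ρ ∈ uIcc (1 : ℝ) s⁻¹, 0 < ρ := fun ρ hρ =>
    (lt_min one_pos (inv_pos.2 hs)).trans_le hρ.1
  split_ifs with h
  · subst h
    have : ∫ ρ in (1 : ℝ)..s⁻¹, ρ ^ n / ρ ^ (n + 1) = ∫ ρ in (1 : ℝ)..s⁻¹, ρ⁻¹ := by
      refine intervalIntegral.integral_congr fun ρ hρ => ?_
      have := hpos ρ hρ
      rw [pow_succ]
      field_simp
    rw [this, integral_inv_of_pos one_pos (inv_pos.2 hs)]
    simp
  · have : ∫ ρ in (1 : ℝ)..s⁻¹, ρ ^ m / ρ ^ (n + 1)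
        = ∫ ρ in (1 : ℝ)..s⁻¹, ρ ^ ((m : ℤ) - (n + 1 : ℕ)) := by
      refine intervalIntegral.integral_congr fun ρ hρ => ?_
      rw [zpow_sub₀ (hpos ρ hρ).ne', zpow_natCast, zpow_natCast]
    have hne : (m : ℝ) - n ≠ 0 := sub_ne_zero.2 fun e => h (Nat.cast_injective e).symm
    rw [this, integral_zpow (Or.inr ⟨by push_cast; omega, fun h0 => lt_irrefl _ (hpos 0 h0)⟩)]
    have e1 : ((m : ℤ) - (n + 1 : ℕ) + 1) = (m : ℤ) - (n : ℕ) := by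
      push_cast
      ring
    have e2 : (((m : ℤ) - (n + 1 : ℕ) : ℤ) : ℝ) + 1 = m - n := by
      push_cast
      ring
    rw [e1, e2, one_zpow, add_zero, zpow_sub₀ (inv_ne_zero hs.ne'), zpow_natCast, zpow_natCast,
      inv_pow, inv_pow]
    field_simp

lemma integral_pow_mul_expansion {E : ℝ → ℝ} (hE : Continuous E) (d : ℕ → ℝ) {m N : ℕ}
    (hm : m ≤ N) {K : ℝ}
    (hd : ∀ ρ : ℝ, 1 ≤ ρ →
      |E ρ - ∑ n ∈ Finset.range (N + 1), d n / ρ ^ (n + 1)| ≤ K / ρ ^ (N + 2)) :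
    ∃ (c : ℕ → ℝ) (C : ℝ), ∀ s : ℝ, 0 < s → s ≤ 1 →
      |s ^ m * (∫ ρ in (0 : ℝ)..s⁻¹, ρ ^ m * E ρ)
        - ((∑ n ∈ Finset.range (N + 1), c n * s ^ n) - d m * (s ^ m * Real.log s))|
        ≤ C * s ^ (N + 1) := by
  set r : ℝ → ℝ := fun ρ => ρ ^ m * (E ρ - ∑ n ∈ Finset.range (N + 1), d n / ρ ^ (n + 1)) with hr
  set q : ℝ := (m : ℝ) - (N + 2) with hq
  have hq1 : q < -1 := by
    have : (m : ℝ) ≤ N := by exact_mod_cast hm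
    rw [hq]
    linarith
  have hrb : ∀ ρ : ℝ, 1 ≤ ρ → ‖r ρ‖ ≤ K * ρ ^ q := by
    intro ρ hρ
    have hρ0 : 0 < ρ := by linarith
    rw [hr, Real.norm_eq_abs, abs_mul, abs_of_pos (pow_pos hρ0 m), hq, Real.rpow_sub hρ0,
      Real.rpow_natCast, show ((N : ℝ) + 2) = ((N + 2 : ℕ) : ℝ) by push_cast; ring,
      Real.rpow_natCast]
    calc ρ ^ m * |E ρ - ∑ n ∈ Finset.range (N + 1), d n / ρ ^ (n + 1)|
        ≤ ρ ^ m * (K / ρ ^ (N + 2)) := by gcongr; exact hd ρ hρ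
      _ = _ := by ring
  have hrm : Measurable r := by
    have := hE.measurable
    fun_prop
  have hri : ∀ R : ℝ, 1 ≤ R → IntegrableOn r (Ioi R) := by
    intro R hR
    refine Integrable.mono' ((integrableOn_Ioi_rpow_of_lt hq1 (by linarith)).const_mul K)
      hrm.aestronglyMeasurable ?_
    rw [ae_restrict_iff' measurableSet_Ioi]
    exact ae_of_all _ fun ρ (hρ : R < ρ) => hrb ρ (by linarith)
  set T : ℝ := (∫ ρ in (0 : ℝ)..1, ρ ^ m * E ρ) + ∫ ρ in Ioi (1 : ℝ), r ρ with hT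
  set S : ℝ := ∑ j ∈ Finset.range (N + 1), d j / ((m : ℝ) - j) with hS
  refine ⟨fun n => d n / ((m : ℝ) - n) + if n = m then T - S else 0, K / (N + 1 - m), ?_⟩
  intro s hs hs1
  have hR : 1 ≤ s⁻¹ := (one_le_inv₀ hs).2 hs1
  have hR0 : 0 < s⁻¹ := inv_pos.2 hs
  have hEi : ∀ x y : ℝ, IntervalIntegrable (fun ρ => ρ ^ m * E ρ) volume x y := fun x y =>
    (by fun_prop : Continuous fun ρ => ρ ^ m * E ρ).intervalIntegrable x y
  have hpos : ∀ ρ ∈ uIcc (1 : ℝ) s⁻¹, ρ ≠ 0 := fun ρ hρ =>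
    ((lt_min one_pos hR0).trans_le hρ.1).ne'
  have hpi : ∀ n : ℕ, IntervalIntegrable (fun ρ : ℝ => d n * (ρ ^ m / ρ ^ (n + 1))) volume 1 s⁻¹ := by
    intro n
    refine ContinuousOn.intervalIntegrable ?_
    refine continuousOn_const.mul ((continuousOn_pow m).div (continuousOn_pow _) fun ρ hρ =>
      pow_ne_zero _ (hpos ρ hρ))
  have hrI : IntervalIntegrable r volume 1 s⁻¹ := by
    rw [intervalIntegrable_iff_integrableOn_Ioc_of_le hR]
    exact (hri 1 le_rfl).mono_set Ioc_subset_Ioi_self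
  have hsI := IntervalIntegrable.sum (Finset.range (N + 1)) fun n _ => hpi n
  rw [Finset.sum_fn] at hsI
  have hsplit : ∫ ρ in (1 : ℝ)..s⁻¹, ρ ^ m * E ρ
      = (∫ ρ in (1 : ℝ)..s⁻¹, r ρ)
        + ∑ n ∈ Finset.range (N + 1), d n * ∫ ρ in (1 : ℝ)..s⁻¹, ρ ^ m / ρ ^ (n + 1) := by
    simp_rw [← intervalIntegral.integral_const_mul]
    rw [← intervalIntegral.integral_finsetSum fun n _ => hpi n,
      ← intervalIntegral.integral_add hrI hsI]
    refine intervalIntegral.integral_congr fun ρ _ => ?_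
    simp only [hr, mul_sub, Finset.mul_sum]
    rw [eq_comm, sub_add_eq_add_sub, sub_eq_iff_eq_add]
    congr 1
    exact Finset.sum_congr rfl fun n _ => by ring
  have htail : ∫ ρ in (1 : ℝ)..s⁻¹, r ρ = (∫ ρ in Ioi (1 : ℝ), r ρ) - ∫ ρ in Ioi s⁻¹, r ρ :=
    intervalIntegral.integral_Ioi_sub_Ioi (hri 1 le_rfl) hR |>.symm
  have hbound : |∫ ρ in Ioi s⁻¹, r ρ| ≤ K * (-(s⁻¹) ^ (q + 1) / (q + 1)) := by
    rw [← integral_Ioi_rpow_of_lt hq1 hR0, ← integral_const_mul, ← Real.norm_eq_abs]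
    refine norm_integral_le_of_norm_le ((integrableOn_Ioi_rpow_of_lt hq1 hR0).const_mul K) ?_
    rw [ae_restrict_iff' measurableSet_Ioi]
    exact ae_of_all _ fun ρ (hρ : s⁻¹ < ρ) => hrb ρ (by linarith)
  have hmN : m ∈ Finset.range (N + 1) := Finset.mem_range.2 (by omega)
  have hsum : s ^ m * ∑ n ∈ Finset.range (N + 1), d n * ∫ ρ in (1 : ℝ)..s⁻¹, ρ ^ m / ρ ^ (n + 1)
      = (∑ n ∈ Finset.range (N + 1), d n / ((m : ℝ) - n) * s ^ n) - S * s ^ m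
        - d m * (s ^ m * Real.log s) := by
    have : ∀ n ∈ Finset.range (N + 1),
        s ^ m * (d n * ∫ ρ in (1 : ℝ)..s⁻¹, ρ ^ m / ρ ^ (n + 1))
        = (d n / ((m : ℝ) - n) * s ^ n - d n / ((m : ℝ) - n) * s ^ m)
          - if n = m then d n * (s ^ m * Real.log s) else 0 := by
      intro n _
      rw [mul_left_comm, pow_mul_integral_pow_div_pow hs]
      split_ifs <;> ring
    rw [Finset.mul_sum, Finset.sum_congr rfl this, Finset.sum_sub_distrib, Finset.sum_sub_distrib,
      ← Finset.sum_mul, Finset.sum_ite_eq' _ m, if_pos hmN]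
  have hcs : ∑ n ∈ Finset.range (N + 1),
      (d n / ((m : ℝ) - n) + if n = m then T - S else 0) * s ^ n
      = (∑ n ∈ Finset.range (N + 1), d n / ((m : ℝ) - n) * s ^ n) + (T - S) * s ^ m := by
    simp_rw [add_mul, ite_mul, zero_mul]
    rw [Finset.sum_add_distrib, Finset.sum_ite_eq' _ m, if_pos hmN]
  have hmain : s ^ m * (∫ ρ in (0 : ℝ)..s⁻¹, ρ ^ m * E ρ)
      - ((∑ n ∈ Finset.range (N + 1),
        (d n / ((m : ℝ) - n) + if n = m then T - S else 0) * s ^ n)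
        - d m * (s ^ m * Real.log s)) = -(s ^ m * ∫ ρ in Ioi s⁻¹, r ρ) := by
    rw [hcs, ← intervalIntegral.integral_add_adjacent_intervals (hEi 0 1) (hEi 1 s⁻¹), hsplit,
      mul_add, mul_add, hsum, htail, hT]
    ring
  rw [hmain, abs_neg, abs_mul, abs_of_pos (pow_pos hs m)]
  refine (mul_le_mul_of_nonneg_left hbound (pow_pos hs m).le).trans (le_of_eq ?_)
  have hpw : s ^ m * (s⁻¹) ^ (q + 1) = s ^ (N + 1) := by
    rw [Real.inv_rpow hs.le, ← Real.rpow_neg hs.le, ← Real.rpow_natCast, ← Real.rpow_add hs,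
      ← Real.rpow_natCast]
    congr 1
    rw [hq]
    push_cast
    ring
  have hq' : q + 1 = -((N : ℝ) + 1 - m) := by
    rw [hq]
    ring
  calc s ^ m * (K * (-(s⁻¹) ^ (q + 1) / (q + 1)))
      = K / (-(q + 1)) * (s ^ m * (s⁻¹) ^ (q + 1)) := by
        rw [div_neg, neg_div]
        ring
    _ = _ := by rw [hpw, hq', neg_neg]

lemma setIntegral_ite_le {F : ℝ → ℝ} {x : ℝ} (hx : x ∈ Ioc (0 : ℝ) 1) :
    ∫ y in Ioc (0 : ℝ) 1, (if y ≤ x then F y else 0) = ∫ y in (0 : ℝ)..x, F y := by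
  have : (fun y => if y ≤ x then F y else 0) = (Iic x).indicator F := by
    ext y
    simp [indicator_apply]
  rw [this, integral_indicator measurableSet_Iic, Measure.restrict_restrict measurableSet_Iic,
    intervalIntegral.integral_of_le hx.1.le, inter_comm, Ioc_inter_Iic, min_eq_right hx.2]

lemma setIntegral_ite_lt {F : ℝ → ℝ} {x : ℝ} (hx : x ∈ Ioc (0 : ℝ) 1) :
    ∫ y in Ioc (0 : ℝ) 1, (if y < x then F y else 0) = ∫ y in (0 : ℝ)..x, F y := by
  rw [← setIntegral_ite_le hx]
  refine setIntegral_congr_ae measurableSet_Ioc ?_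
  filter_upwards [Measure.ae_ne volume x] with y hy _
  simp only [lt_iff_le_and_ne, hy, ne_eq, not_false_eq_true, and_true]

lemma integral_square_eq_add_triangles {K : ℝ → ℝ → ℝ}
    (hK : Integrable (Function.uncurry K)
      ((volume.restrict (Ioc (0 : ℝ) 1)).prod (volume.restrict (Ioc (0 : ℝ) 1)))) :
    ∫ x in (0 : ℝ)..1, ∫ y in (0 : ℝ)..1, K x y
      = (∫ x in (0 : ℝ)..1, ∫ y in (0 : ℝ)..x, K x y)
        + ∫ y in (0 : ℝ)..1, ∫ x in (0 : ℝ)..y, K x y := by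
  have h1 : Integrable (Function.uncurry fun x y => if y ≤ x then K x y else 0)
      ((volume.restrict (Ioc (0 : ℝ) 1)).prod (volume.restrict (Ioc (0 : ℝ) 1))) := by
    have := hK.indicator (measurableSet_le measurable_snd measurable_fst)
    refine this.congr (ae_of_all _ fun z => ?_)
    simp [indicator_apply, Function.uncurry]
  have h2 : Integrable (Function.uncurry fun x y => if x < y then K x y else 0)
      ((volume.restrict (Ioc (0 : ℝ) 1)).prod (volume.restrict (Ioc (0 : ℝ) 1))) := by
    have := hK.indicator (measurableSet_lt measurable_fst measurable_snd)
    refine this.congr (ae_of_all _ fun z => ?_)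
    simp [indicator_apply, Function.uncurry]
  simp only [intervalIntegral.integral_of_le zero_le_one]
  have e1 : ∫ x in Ioc (0 : ℝ) 1, ∫ y in (0 : ℝ)..x, K x y
      = ∫ x in Ioc (0 : ℝ) 1, ∫ y in Ioc (0 : ℝ) 1, (if y ≤ x then K x y else 0) :=
    setIntegral_congr_fun measurableSet_Ioc fun x hx =>
      (setIntegral_ite_le (F := fun y => K x y) hx).symm
  have e2 : ∫ y in Ioc (0 : ℝ) 1, ∫ x in (0 : ℝ)..y, K x y
      = ∫ y in Ioc (0 : ℝ) 1, ∫ x in Ioc (0 : ℝ) 1, (if x < y then K x y else 0) :=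
    setIntegral_congr_fun measurableSet_Ioc fun y hy =>
      (setIntegral_ite_lt (F := fun x => K x y) hy).symm
  rw [e1, e2, ← integral_integral_swap h2]
  refine Eq.trans ?_ (integral_integral_add h1 h2)
  refine integral_congr_ae (ae_of_all _ fun x => integral_congr_ae (ae_of_all _ fun y => ?_))
  rcases le_or_gt y x with h | h
  · simp [h, h.not_gt]
  · simp [h, h.not_ge]

/-- The Gaussian kernel against a product of two powers. -/
noncomputable def heatKernelPow (a b t x y : ℝ) : ℝ :=
  Real.exp (-(x - y) ^ 2 / (4 * t)) * x ^ (-a) * y ^ (-b)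

lemma integrable_heatKernelPow {a b t : ℝ} (ha : a < 1) (hb : b < 1) (ht : 0 < t) :
    Integrable (Function.uncurry (heatKernelPow a b t))
      ((volume.restrict (Ioc (0 : ℝ) 1)).prod (volume.restrict (Ioc (0 : ℝ) 1))) := by
  have hi : ∀ c : ℝ, c < 1 → IntegrableOn (fun x : ℝ => x ^ (-c)) (Ioc 0 1) := fun c hc =>
    (intervalIntegrable_iff_integrableOn_Ioc_of_le zero_le_one).1
      (intervalIntegral.intervalIntegrable_rpow' (by linarith))
  refine Integrable.mono ((hi a ha).mul_prod (hi b hb)) ?_ (ae_of_all _ fun z => ?_)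
  · refine Measurable.aestronglyMeasurable ?_
    unfold heatKernelPow Function.uncurry
    fun_prop
  · simp only [Function.uncurry, heatKernelPow]
    rw [mul_assoc, norm_mul, Real.norm_of_nonneg (Real.exp_pos _).le]
    refine mul_le_of_le_one_left (norm_nonneg _) (Real.exp_le_one_iff.2 ?_)
    exact div_nonpos_of_nonpos_of_nonneg (by nlinarith [sq_nonneg (z.1 - z.2)]) (by positivity)

lemma integral_heatKernelPow_eq {a b s x : ℝ} {k : ℕ} (hab : a + b = 1 - 2 * k) (hs : 0 < s)
    (hx : 0 < x) :
    ∫ y in (0 : ℝ)..x, heatKernelPow a b (s ^ 2) x y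
      = x ^ (2 * k) * boundaryLayer b (s⁻¹ * x) := by
  have h1 := intervalIntegral.mul_integral_comp_mul_left (a := 0) (b := 1)
    (f := fun y => heatKernelPow a b (s ^ 2) x y) x
  have h2 := intervalIntegral.integral_comp_sub_left (a := 0) (b := 1)
    (fun v => heatKernelPow a b (s ^ 2) x (x * v)) 1
  simp only [mul_zero, mul_one, sub_zero, sub_self] at h1 h2
  rw [← h1, ← h2, boundaryLayer_eq, ← intervalIntegral.integral_const_mul,
    ← intervalIntegral.integral_const_mul]
  refine intervalIntegral.integral_congr fun w hw => ?_
  rw [uIcc_of_le zero_le_one] at hw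
  have hpow : x * (x ^ (-a) * x ^ (-b)) = x ^ (2 * k) := by
    have he : ((2 * k : ℕ) : ℝ) = 1 + (-a + -b) := by
      push_cast
      linarith
    rw [← Real.rpow_natCast, he, Real.rpow_add hx, Real.rpow_add hx, Real.rpow_one]
  have hexp : -(x - x * (1 - w)) ^ 2 / (4 * s ^ 2) = -(s⁻¹ * x * w) ^ 2 / 4 := by
    field_simp
    ring
  simp only [heatKernelPow]
  rw [hexp, Real.mul_rpow hx.le (by linarith [hw.2]), ← hpow]
  ring

lemma integral_square_heatKernelPow {a b s : ℝ} {k : ℕ} (ha : a < 1) (hb : b < 1)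
    (hab : a + b = 1 - 2 * k) (hs : 0 < s) :
    ∫ x in (0 : ℝ)..1, ∫ y in (0 : ℝ)..1, heatKernelPow a b (s ^ 2) x y
      = s * (s ^ (2 * k) * ∫ ρ in (0 : ℝ)..s⁻¹,
          ρ ^ (2 * k) * (boundaryLayer a ρ + boundaryLayer b ρ)) := by
  have hsymm : ∀ x y, heatKernelPow a b (s ^ 2) x y = heatKernelPow b a (s ^ 2) y x := by
    intro x y
    simp only [heatKernelPow]
    rw [← neg_sub x y, neg_sq]
    ring
  have hc : ∀ c : ℝ, c < 1 → IntervalIntegrable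
      (fun x : ℝ => x ^ (2 * k) * boundaryLayer c (s⁻¹ * x)) volume 0 1 := by
    intro c hc
    have := continuous_boundaryLayer hc
    exact (by fun_prop : Continuous fun x : ℝ =>
      x ^ (2 * k) * boundaryLayer c (s⁻¹ * x)).intervalIntegrable 0 1
  have hleft : ∀ {a b : ℝ}, a + b = 1 - 2 * k →
      ∫ x in (0 : ℝ)..1, ∫ y in (0 : ℝ)..x, heatKernelPow a b (s ^ 2) x y
        = ∫ x in (0 : ℝ)..1, x ^ (2 * k) * boundaryLayer b (s⁻¹ * x) := by
    intro a b hab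
    simp only [intervalIntegral.integral_of_le zero_le_one]
    exact setIntegral_congr_fun measurableSet_Ioc fun x hx => integral_heatKernelPow_eq hab hs hx.1
  rw [integral_square_eq_add_triangles (integrable_heatKernelPow ha hb (by positivity)), hleft hab]
  simp_rw [hsymm]
  rw [hleft (by linarith), ← intervalIntegral.integral_add (hc b hb) (hc a ha)]
  have h := intervalIntegral.mul_integral_comp_mul_left (a := 0) (b := 1)
    (f := fun ρ : ℝ => ρ ^ (2 * k) * (boundaryLayer a ρ + boundaryLayer b ρ)) s⁻¹
  rw [mul_zero, mul_one] at h
  rw [← h, mul_left_comm, mul_inv_cancel_left₀ hs.ne', ← intervalIntegral.integral_const_mul]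
  refine intervalIntegral.integral_congr fun x _ => ?_
  simp only [mul_pow, inv_pow]
  field_simp
  ring

lemma heatContentI_eq_ofReal (a b : ℝ) (t : ℝ) :
    heatContentI a b t = (((√(4 * Real.pi * t))⁻¹ *
      ∫ x in (0 : ℝ)..1, ∫ y in (0 : ℝ)..1, heatKernelPow a b t x y : ℝ) : ℂ) := by
  rw [heatContentI, Complex.ofReal_mul, Complex.ofReal_inv, ← intervalIntegral.integral_ofReal]
  congr 1
  refine intervalIntegral.integral_congr fun x hx => ?_
  rw [uIcc_of_le zero_le_one] at hx
  rw [← intervalIntegral.integral_ofReal]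
  refine intervalIntegral.integral_congr fun y hy => ?_
  rw [uIcc_of_le zero_le_one] at hy
  simp only [heatKernelPow]
  rw [Complex.ofReal_mul, Complex.ofReal_mul, Complex.ofReal_cpow hx.1, Complex.ofReal_cpow hy.1,
    Complex.ofReal_neg, Complex.ofReal_neg]

lemma prod_range_add_eq_of_add_eq {a b : ℝ} {k : ℕ} (hab : a + b = 1 - 2 * k) :
    ∏ i ∈ Finset.range (2 * k), (b + i) = ∏ i ∈ Finset.range (2 * k), (a + i) := by
  have hneg : ∏ i ∈ Finset.range (2 * k), (a + i) = ∏ i ∈ Finset.range (2 * k), -(a + i) := by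
    rw [Finset.prod_neg]
    simp
  rw [hneg, ← Finset.prod_range_reflect]
  refine Finset.prod_congr rfl fun i hi => ?_
  have hi' : i + 1 ≤ 2 * k := Finset.mem_range.1 hi
  rw [Nat.sub_sub, add_comm 1 i, Nat.cast_sub hi']
  push_cast
  linarith

lemma boundaryLayer_expansion {b : ℝ} (hb : b < 1) (N : ℕ) :
    ∃ K : ℝ, ∀ ρ : ℝ, 1 ≤ ρ →
      |boundaryLayer b ρ - ∑ n ∈ Finset.range (N + 1),
        (∏ i ∈ Finset.range n, (b + i)) / n.factorial * halfGaussianMoment n / ρ ^ (n + 1)|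
        ≤ K / ρ ^ (N + 2) := by
  obtain ⟨C, δ, hC, hδ, h⟩ := truncPow_expansion b N
  exact watson_gaussian (integrableOn_truncPow hb) _ N hC hδ h

lemma real_log_expansion {a b : ℝ} (ha : a < 1) (hb : b < 1) {k N : ℕ}
    (hab : a + b = 1 - 2 * k) (hN : 2 * k ≤ N) :
    ∃ (c : ℕ → ℝ) (C : ℝ), ∀ s : ℝ, 0 < s → s ≤ 1 →
      |(√(4 * Real.pi * s ^ 2))⁻¹ *
          (∫ x in (0 : ℝ)..1, ∫ y in (0 : ℝ)..1, heatKernelPow a b (s ^ 2) x y)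
        - ((∑ n ∈ Finset.range (N + 1), c n * s ^ n)
          - (∏ i ∈ Finset.range (2 * k), (a + i)) / k.factorial * (s ^ (2 * k) * Real.log s))|
        ≤ C * s ^ (N + 1) := by
  obtain ⟨Ka, hKa⟩ := boundaryLayer_expansion ha N
  obtain ⟨Kb, hKb⟩ := boundaryLayer_expansion hb N
  set d : ℕ → ℝ := fun n => ((∏ i ∈ Finset.range n, (a + i)) / n.factorial
    + (∏ i ∈ Finset.range n, (b + i)) / n.factorial) * halfGaussianMoment n with hd
  obtain ⟨c, C, h⟩ := integral_pow_mul_expansion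
    (E := fun ρ => boundaryLayer a ρ + boundaryLayer b ρ)
    ((continuous_boundaryLayer ha).add (continuous_boundaryLayer hb)) d hN (K := Ka + Kb) (by
      intro ρ hρ
      have hsum : ∑ n ∈ Finset.range (N + 1), d n / ρ ^ (n + 1)
          = (∑ n ∈ Finset.range (N + 1),
              (∏ i ∈ Finset.range n, (a + i)) / n.factorial * halfGaussianMoment n / ρ ^ (n + 1))
            + ∑ n ∈ Finset.range (N + 1),
              (∏ i ∈ Finset.range n, (b + i)) / n.factorial * halfGaussianMoment n / ρ ^ (n + 1) := by
        rw [← Finset.sum_add_distrib]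
        exact Finset.sum_congr rfl fun n _ => by simp only [hd, add_mul, add_div]
      rw [hsum, add_sub_add_comm, add_div]
      exact (abs_add_le _ _).trans (add_le_add (hKa ρ hρ) (hKb ρ hρ)))
  have hdk : d (2 * k) = 2 * √Real.pi * ((∏ i ∈ Finset.range (2 * k), (a + i)) / k.factorial) := by
    simp only [hd]
    rw [prod_range_add_eq_of_add_eq hab, halfGaussianMoment_two_mul]
    field_simp
    ring
  have hc : 0 < (2 * √Real.pi)⁻¹ := inv_pos.2 (by positivity)
  refine ⟨fun n => (2 * √Real.pi)⁻¹ * c n, (2 * √Real.pi)⁻¹ * C, fun s hs hs1 => ?_⟩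
  have hsq : √(4 * Real.pi * s ^ 2) = 2 * √Real.pi * s := by
    rw [Real.sqrt_mul (mul_pos four_pos Real.pi_pos).le, Real.sqrt_sq hs.le, Real.sqrt_mul (by norm_num),
      show (4 : ℝ) = 2 ^ 2 by norm_num, Real.sqrt_sq (by norm_num)]
  have hfac : (√(4 * Real.pi * s ^ 2))⁻¹ *
        (∫ x in (0 : ℝ)..1, ∫ y in (0 : ℝ)..1, heatKernelPow a b (s ^ 2) x y)
      - ((∑ n ∈ Finset.range (N + 1), (2 * √Real.pi)⁻¹ * c n * s ^ n)
        - (∏ i ∈ Finset.range (2 * k), (a + i)) / k.factorial * (s ^ (2 * k) * Real.log s))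
      = (2 * √Real.pi)⁻¹ * (s ^ (2 * k) * (∫ ρ in (0 : ℝ)..s⁻¹,
          ρ ^ (2 * k) * (boundaryLayer a ρ + boundaryLayer b ρ))
        - ((∑ n ∈ Finset.range (N + 1), c n * s ^ n) - d (2 * k) * (s ^ (2 * k) * Real.log s))) := by
    rw [integral_square_heatKernelPow ha hb hab hs, hsq, hdk]
    simp_rw [mul_assoc (2 * √Real.pi)⁻¹ (c _)]
    rw [← Finset.mul_sum]
    field_simp
  rw [hfac, abs_mul, abs_of_pos hc]
  exact (mul_le_mul_of_nonneg_left (h s hs hs1) hc.le).trans_eq (mul_assoc _ _ _).symm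

/-- Theorem 3.2: when `a + b = 1 - 2k`, the heat content `h_{a,b}(t)` admits a complete
asymptotic expansion with a logarithmic term whose coefficient is
`-a(a+1)⋯(a+2k-1)/(2·k!)`. -/
theorem heatContentI_log_expansion
    (a b : ℝ) (ha : a < 1) (hb : b < 1) (k : ℕ) (hab : a + b = 1 - 2 * k)
    (N : ℕ) (hN : 2 * k + 1 ≤ N) :
    ∃ c : ℕ → ℝ, ∃ C > 0, ∃ t₀ > 0, ∀ t : ℝ, 0 < t → t < t₀ →
      ‖heatContentI (a : ℂ) (b : ℂ) t
          - ((∑ n ∈ Finset.range (N + 1), (c n : ℂ) * (t : ℂ) ^ ((n : ℂ) / 2))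
            - ((∏ i ∈ Finset.range (2 * k), ((a : ℂ) + i)) / (2 * (k.factorial : ℂ)))
                * (t : ℂ) ^ k * (↑(Real.log t) : ℂ))‖
        ≤ C * t ^ ((N + 1 : ℝ) / 2) := by
  obtain ⟨c, C, h⟩ := real_log_expansion ha hb hab (show 2 * k ≤ N by omega)
  refine ⟨c, |C| + 1, by positivity, 1, one_pos, fun t ht ht1 => ?_⟩
  have hs : 0 < √t := Real.sqrt_pos.2 ht
  have hs1 : √t ≤ 1 := Real.sqrt_le_one.2 ht1.le
  have hst : √t ^ 2 = t := Real.sq_sqrt ht.le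
  have hpow : ∀ n : ℕ, (t : ℂ) ^ ((n : ℂ) / 2) = ((√t ^ n : ℝ) : ℂ) := by
    intro n
    rw [Real.sqrt_eq_rpow, ← Real.rpow_mul_natCast ht.le, Complex.ofReal_cpow ht.le]
    congr 1
    push_cast
    ring
  have hlog : Real.log t = 2 * Real.log (√t) := by
    rw [Real.log_sqrt ht.le]
    ring
  have hN1 : t ^ ((N + 1 : ℝ) / 2) = √t ^ (N + 1) := by
    rw [Real.sqrt_eq_rpow, ← Real.rpow_mul_natCast ht.le]
    congr 1
    push_cast
    ring
  have hb := h (√t) hs hs1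
  rw [hst, pow_mul, hst] at hb
  have hcast : heatContentI (a : ℂ) (b : ℂ) t
      - ((∑ n ∈ Finset.range (N + 1), (c n : ℂ) * (t : ℂ) ^ ((n : ℂ) / 2))
        - ((∏ i ∈ Finset.range (2 * k), ((a : ℂ) + i)) / (2 * (k.factorial : ℂ)))
          * (t : ℂ) ^ k * (↑(Real.log t) : ℂ))
      = (((√(4 * Real.pi * t))⁻¹ *
          (∫ x in (0 : ℝ)..1, ∫ y in (0 : ℝ)..1, heatKernelPow a b t x y)
        - ((∑ n ∈ Finset.range (N + 1), c n * √t ^ n)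
          - (∏ i ∈ Finset.range (2 * k), (a + i)) / k.factorial * (t ^ k * Real.log (√t))) : ℝ) : ℂ) := by
    rw [heatContentI_eq_ofReal, hlog]
    simp_rw [hpow]
    push_cast
    field_simp
  rw [hcast, Complex.norm_real, Real.norm_eq_abs, hN1]
  refine hb.trans ?_
  gcongr
  linarith [le_abs_self C]
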